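/- arXiv:2601.01565 — 2 statements merged into one kernel-verified Lean document; each statement's English description precedes it below -/
import Mathlib

section
/- Let n ≥ 2 and let φ : S^n → S^n be a diffeomorphism of the unit sphere such that the image under φ of every equator of S^n is again an equator. Then there exists T ∈ GL(n+1,ℝ) such that φ(x) = T(x)/|T(x)| for every x ∈ S^n. -/
def I2 {V : Type*} [AddCommGroup V] [Module ℝ V] (x y : V) : Prop :=
  ∀ a b : ℝ, a • x + b • y = 0 → a = 0 ∧ b = 0
def I3 {V : Type*} [AddCommGroup V] [Module ℝ V] (x y z : V) : Prop :=
  ∀ a b c : ℝ, a • x + b • y + c • z = 0 → a = 0 ∧ b = 0 ∧ c = 0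

/-- the collineation hypotheses -/
structure Coll {V : Type*} [AddCommGroup V] [Module ℝ V] (Φ : V → V) : Prop where
  smul : ∀ (t : ℝ) x, Φ (t • x) = t • Φ x
  i2 : ∀ x y, I2 x y → I2 (Φ x) (Φ y)
  i3 : ∀ x y z, I3 x y z → I3 (Φ x) (Φ y) (Φ z)
  sp : ∀ x y, I2 x y → ∀ a b : ℝ, ∃ c d : ℝ, Φ (a • x + b • y) = c • Φ x + d • Φ y
  ne : ∀ x, x ≠ 0 → Φ x ≠ 0

def GP {V : Type*} [AddCommGroup V] [Module ℝ V] (Φ : V → V) (e x w : V) : Prop :=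
  (∃ a : ℝ, a ≠ 0 ∧ Φ x = a • w) ∧ ∃ a : ℝ, a ≠ 0 ∧ Φ (e + x) = a • (Φ e + w)

section
variable {V : Type*} [AddCommGroup V] [Module ℝ V] {Φ : V → V}

lemma I3.i12 {x y z : V} (h : I3 x y z) : I2 x y := fun a b hab => by
  obtain ⟨h1, h2, -⟩ := h a b 0 (by rw [← hab]; module)
  exact ⟨h1, h2⟩
lemma I3.i13 {x y z : V} (h : I3 x y z) : I2 x z := fun a b hab => by
  obtain ⟨h1, -, h2⟩ := h a 0 b (by rw [← hab]; module)
  exact ⟨h1, h2⟩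
lemma I3.i23 {x y z : V} (h : I3 x y z) : I2 y z := fun a b hab => by
  obtain ⟨-, h1, h2⟩ := h 0 a b (by rw [← hab]; module)
  exact ⟨h1, h2⟩
lemma I3.swap {x y z : V} (h : I3 x y z) : I3 x z y := fun a b c hab => by
  obtain ⟨h0, h1, h2⟩ := h a c b (by rw [← hab]; module)
  exact ⟨h0, h2, h1⟩
lemma I2.swap {x y : V} (h : I2 x y) : I2 y x := fun a b hab => by
  obtain ⟨h1, h2⟩ := h b a (by rw [← hab]; module)
  exact ⟨h2, h1⟩
lemma I2.ne_right {x y : V} (h : I2 x y) : y ≠ 0 := by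
  rintro rfl
  have := (h 0 1 (by simp)).2
  norm_num at this

lemma GP.unique (hΦ : Coll Φ) {e x w w' : V} (he : I2 e x) (h : GP Φ e x w) (h' : GP Φ e x w') :
    w = w' := by
  obtain ⟨⟨a, ha, h1⟩, b, hb, h2⟩ := h
  obtain ⟨⟨a', ha', h1'⟩, b', hb', h2'⟩ := h'
  have hw : w = a⁻¹ • Φ x := by rw [h1, smul_smul, inv_mul_cancel₀ ha, one_smul]
  have hw' : w' = a'⁻¹ • Φ x := by rw [h1', smul_smul, inv_mul_cancel₀ ha', one_smul]
  rw [h2] at h2'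
  rw [hw, hw'] at h2' ⊢
  obtain ⟨h3, h4⟩ := hΦ.i2 _ _ he (b - b') (b * a⁻¹ - b' * a'⁻¹) (by
    linear_combination (norm := module) h2')
  have h5 : b = b' := by linarith
  subst h5
  have : a⁻¹ = a'⁻¹ := by
    apply mul_left_cancel₀ hb; linarith
  rw [this]

lemma GP.exists (hΦ : Coll Φ) {e x : V} (he : I2 e x) : ∃ w, GP Φ e x w := by
  obtain ⟨c, d, h⟩ := hΦ.sp e x he 1 1
  simp only [one_smul] at h
  have hc : c ≠ 0 := by
    rintro rfl
    have := hΦ.i2 (e + x) x (fun a b hab => by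
      obtain ⟨h1, h2⟩ := he a (a + b) (by rw [← hab]; module)
      exact ⟨h1, by linarith⟩)
    obtain ⟨h1, -⟩ := this 1 (-d) (by rw [h]; module)
    norm_num at h1
  have hd : d ≠ 0 := by
    rintro rfl
    have := hΦ.i2 (e + x) e (fun a b hab => by
      obtain ⟨h1, h2⟩ := he (a + b) a (by rw [← hab]; module)
      exact ⟨h2, by linarith⟩)
    obtain ⟨h1, -⟩ := this 1 (-c) (by rw [h]; module)
    norm_num at h1
  refine ⟨(c⁻¹ * d) • Φ x, ⟨d⁻¹ * c, by positivity, ?_⟩, c, hc, ?_⟩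
  · rw [smul_smul]; field_simp; simp
  · rw [h, smul_add, smul_smul]; field_simp

lemma GP.add (hΦ : Coll Φ) {e x y X Y : V} (he : I3 e x y) (h : GP Φ e x X) (h' : GP Φ e y Y) :
    GP Φ e (x + y) (X + Y) := by
  obtain ⟨⟨a, ha, h1⟩, b, hb, h2⟩ := h
  obtain ⟨⟨a', ha', h1'⟩, b', hb', h2'⟩ := h'
  have hI : I3 (Φ e) X Y := by
    intro p q r hpq
    obtain ⟨k1, k2, k3⟩ := hΦ.i3 _ _ _ he p (q * a⁻¹) (r * a'⁻¹) (by
      rw [h1, h1', smul_smul, smul_smul, mul_assoc, mul_assoc, inv_mul_cancel₀ ha,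
        inv_mul_cancel₀ ha', mul_one, mul_one, hpq])
    simp only [mul_eq_zero, inv_eq_zero, ha, ha', or_false] at k2 k3
    exact ⟨k1, k2, k3⟩
  obtain ⟨c1, d1, e1⟩ := hΦ.sp (e + x) y (fun a b hab => by
      obtain ⟨h1, h2, h3⟩ := he a a b (by rw [← hab]; module)
      exact ⟨h1, h3⟩) 1 1
  obtain ⟨c2, d2, e2⟩ := hΦ.sp (e + y) x (fun a b hab => by
      obtain ⟨h1, h2, h3⟩ := he a b a (by rw [← hab]; module)
      exact ⟨h1, h2⟩) 1 1
  obtain ⟨c3, d3, e3⟩ := hΦ.sp x y he.i23 1 1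
  obtain ⟨c4, d4, e4⟩ := hΦ.sp (e + (x + y)) e (fun a b hab => by
      obtain ⟨h1, h2, h3⟩ := he (a + b) a a (by rw [← hab]; module)
      exact ⟨h2, by linarith⟩) 1 (-1)
  have n1 : Φ (e + (x + y)) ≠ 0 := hΦ.ne _ (fun h0 => by
    obtain ⟨h1, -⟩ := he 1 1 1 (by rw [← h0]; module)
    norm_num at h1)
  have n2 : Φ (x + y) ≠ 0 := hΦ.ne _ (fun h0 => by
    obtain ⟨-, h1, -⟩ := he 0 1 1 (by rw [← h0]; module)
    norm_num at h1)
  rw [show (1:ℝ) • (e + x) + (1:ℝ) • y = e + (x + y) by module, h2, h1'] at e1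
  rw [show (1:ℝ) • (e + y) + (1:ℝ) • x = e + (x + y) by module, h2', h1] at e2
  rw [show (1:ℝ) • x + (1:ℝ) • y = x + y by module, h1, h1'] at e3
  rw [show (1:ℝ) • (e + (x + y)) + (-1:ℝ) • e = x + y by module] at e4
  obtain ⟨k1, k2, k3⟩ := hI (c1 * b - c2 * b') (c1 * b - d2 * a) (d1 * a' - c2 * b') (by
    linear_combination (norm := module) e2 - e1)
  have e5 : Φ (e + (x + y)) = (c1 * b) • (Φ e + (X + Y)) := by
    have : d1 * a' = c1 * b := by linarith
    rw [e1, smul_smul, smul_smul, this]; module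
  rw [e5] at e4
  obtain ⟨m1, m2, m3⟩ := hI (c4 * (c1 * b) + d4) (c4 * (c1 * b) - c3 * a) (c4 * (c1 * b) - d3 * a') (by
    linear_combination (norm := module) e3 - e4)
  have e6 : Φ (x + y) = (c3 * a) • (X + Y) := by
    have : d3 * a' = c3 * a := by linarith
    rw [e3, smul_smul, smul_smul, this]; module
  refine ⟨⟨_, ?_, e6⟩, _, ?_, e5⟩
  · intro h0; rw [h0, zero_smul] at e6; exact n2 e6
  · intro h0; rw [h0, zero_smul] at e5; exact n1 e5

lemma I3.of_ker {e x y : V} (ℓ : V →ₗ[ℝ] ℝ) (hℓ : ℓ e = 1) (hx : ℓ x = 0) (hy : ℓ y = 0)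
    (hx0 : x ≠ 0) (hn : ¬ ∃ t : ℝ, y = t • x) : I3 e x y := by
  intro a b c habc
  have ha : a = 0 := by
    have := congrArg ℓ habc
    simpa [hℓ, hx, hy] using this
  subst ha
  have hc : c = 0 := by
    by_contra hc
    refine hn ⟨-(c⁻¹ * b), ?_⟩
    have : c⁻¹ • ((0:ℝ) • e + b • x + c • y) = c⁻¹ • (0 : V) := by rw [habc]
    rw [smul_add, smul_smul c⁻¹ c, inv_mul_cancel₀ hc, one_smul, smul_zero] at this
    linear_combination (norm := module) this
  subst hc
  refine ⟨rfl, ?_, rfl⟩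
  simpa [hx0] using habc

lemma I2.of_ker {e x : V} (ℓ : V →ₗ[ℝ] ℝ) (hℓ : ℓ e = 1) (hx : ℓ x = 0)
    (hx0 : x ≠ 0) : I2 e x := by
  intro a b habc
  have ha : a = 0 := by
    have := congrArg ℓ habc
    simpa [hℓ, hx] using this
  subst ha
  refine ⟨rfl, ?_⟩
  simpa [hx0] using habc

lemma ftpg (hΦ : Coll Φ) (e : V) (ℓ : V →ₗ[ℝ] ℝ) (hℓ : ℓ e = 1)
    (h3 : ∀ x y : V, I2 x y → ∃ z, I3 x y z) (hV : ∃ x, I2 e x) :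
    ∃ T : V →ₗ[ℝ] V, Function.Injective T ∧ ∀ x, ∃ c : ℝ, c ≠ 0 ∧ Φ x = c • T x := by
  classical
  have hex : ∀ x, ∃ w, (I2 e x → GP Φ e x w) ∧ (¬ I2 e x → w = 0) := by
    intro x
    by_cases hx : I2 e x
    · obtain ⟨w, hw⟩ := GP.exists hΦ hx
      exact ⟨w, fun _ => hw, fun h => absurd hx h⟩
    · exact ⟨0, fun h => absurd h hx, fun _ => rfl⟩
  choose g hg hg0' using hex
  have hg0 : g 0 = 0 := hg0' 0 (fun h => h.ne_right rfl)
  have hΦ0 : Φ 0 = 0 := by simpa using hΦ.smul 0 0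
  have gadd3 : ∀ x y, I3 e x y → g (x + y) = g x + g y := by
    intro x y hxy
    have h2 : I2 e (x + y) := fun a b hab => by
      obtain ⟨h1, h2, -⟩ := hxy a b b (by rw [← hab]; module)
      exact ⟨h1, h2⟩
    exact GP.unique hΦ h2 (hg _ h2) (GP.add hΦ hxy (hg _ hxy.i12) (hg _ hxy.i13))
  have hthird : ∀ x, ℓ x = 0 → x ≠ 0 → ∃ z, ℓ z = 0 ∧ I3 e x z := by
    intro x hx hx0
    obtain ⟨z, hz⟩ := h3 e x (I2.of_ker ℓ hℓ hx hx0)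
    refine ⟨z - ℓ z • e, by simp [hℓ], fun a b c habc => ?_⟩
    obtain ⟨h1, h2, h3⟩ := hz (a - c * ℓ z) b c (by rw [← habc]; module)
    exact ⟨by rw [h3] at h1; linarith, h2, h3⟩
  have gadd : ∀ x y, ℓ x = 0 → ℓ y = 0 → g (x + y) = g x + g y := by
    intro x y hx hy
    by_cases hx0 : x = 0
    · simp [hx0, hg0]
    by_cases hy0 : y = 0
    · simp [hy0, hg0]
    by_cases ht : ∃ t : ℝ, y = t • x
    · obtain ⟨t, rfl⟩ := ht
      have ht0 : t ≠ 0 := by rintro rfl; simp at hy0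
      obtain ⟨z, hz, hI⟩ := hthird x hx hx0
      have e1 : g (x + (t • x + z)) = g x + g (t • x + z) := gadd3 _ _ (fun a b c habc => by
        obtain ⟨h1, h2, h3⟩ := hI a (b + c * t) c (by rw [← habc]; module)
        exact ⟨h1, by rw [h3] at h2; linarith, h3⟩)
      have e2 : g (t • x + z) = g (t • x) + g z := gadd3 _ _ (fun a b c habc => by
        obtain ⟨h1, h2, h3⟩ := hI a (b * t) c (by rw [← habc]; module)
        exact ⟨h1, (mul_eq_zero.1 h2).resolve_right ht0, h3⟩)
      have e3 : g ((x + t • x) + z) = g (x + t • x) + g z := by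
        by_cases h0 : x + t • x = 0
        · simp [h0, hg0]
        have h1t : 1 + t ≠ 0 := fun h => h0 (by
          rw [show x + t • x = (1 + t) • x by module, h, zero_smul])
        exact gadd3 _ _ (fun a b c habc => by
          obtain ⟨h1, h2, h3⟩ := hI a (b * (1 + t)) c (by rw [← habc]; module)
          exact ⟨h1, (mul_eq_zero.1 h2).resolve_right h1t, h3⟩)
      rw [add_assoc, e1, e2] at e3
      linear_combination (norm := module) -e3
    · exact gadd3 _ _ (I3.of_ker ℓ hℓ hx hy hx0 ht)
  have gline : ∀ (t : ℝ) x, ℓ x = 0 → ∃ s : ℝ, g (t • x) = s • g x := by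
    intro t x hx
    by_cases hx0 : t • x = 0
    · exact ⟨0, by simp [hx0, hg0]⟩
    have hx1 : x ≠ 0 := fun h => hx0 (by simp [h])
    obtain ⟨⟨a, ha, h1⟩, -⟩ := hg (t • x) (I2.of_ker ℓ hℓ (by simp [hx]) hx0)
    obtain ⟨⟨b, hb, h2⟩, -⟩ := hg x (I2.of_ker ℓ hℓ hx hx1)
    refine ⟨a⁻¹ * (t * b), ?_⟩
    rw [hΦ.smul, h2] at h1
    rw [← smul_smul, ← smul_smul, h1, smul_smul, inv_mul_cancel₀ ha, one_smul]
  have gne : ∀ x, ℓ x = 0 → x ≠ 0 → g x ≠ 0 := by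
    intro x hx hx0 h0
    obtain ⟨⟨b, hb, h2⟩, -⟩ := hg x (I2.of_ker ℓ hℓ hx hx0)
    rw [h0, smul_zero] at h2
    exact hΦ.ne x hx0 h2
  have gI2 : ∀ x y, I3 e x y → I2 (g x) (g y) := by
    intro x y hxy a b hab
    obtain ⟨⟨p, hp, h1⟩, -⟩ := hg x hxy.i12
    obtain ⟨⟨q, hq, h2⟩, -⟩ := hg y hxy.i13
    obtain ⟨k1, k2⟩ := hΦ.i2 _ _ hxy.i23 (a * p⁻¹) (b * q⁻¹) (by
      rw [h1, h2, smul_smul, smul_smul, mul_assoc, mul_assoc, inv_mul_cancel₀ hp,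
        inv_mul_cancel₀ hq, mul_one, mul_one, hab])
    simpa [hp, hq] using And.intro k1 k2
  choose! σ hσ using gline
  have σeq : ∀ x y, ℓ x = 0 → ℓ y = 0 → I3 e x y → ∀ t, σ t x = σ t y := by
    intro x y hx hy hxy t
    have e1 := hσ t (x + y) (by simp [hx, hy])
    rw [smul_add, gadd _ _ (by simp [hx]) (by simp [hy]), hσ t x hx, hσ t y hy, gadd _ _ hx hy] at e1
    obtain ⟨k1, k2⟩ := gI2 x y hxy (σ t x - σ t (x + y)) (σ t y - σ t (x + y)) (by
      linear_combination (norm := module) e1)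
    linarith
  obtain ⟨x0, hx0, hx0'⟩ : ∃ x, ℓ x = 0 ∧ x ≠ 0 := by
    obtain ⟨x, hx⟩ := hV
    refine ⟨x - ℓ x • e, by simp [hℓ], fun h => ?_⟩
    have := (hx (-ℓ x) 1 (by rw [← h]; module)).2
    norm_num at this
  obtain ⟨y0, hy0, hI0⟩ := hthird x0 hx0 hx0'
  have hs : ∀ t x, ℓ x = 0 → g (t • x) = σ t x0 • g x := by
    intro t x hx
    by_cases hx' : x = 0
    · simp [hx', hg0]
    rw [hσ t x hx]
    congr 1
    by_cases ht : ∃ t : ℝ, x = t • x0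
    · obtain ⟨r, rfl⟩ := ht
      have hr : r ≠ 0 := by rintro rfl; simp at hx'
      rw [σeq x0 y0 hx0 hy0 hI0]
      apply σeq _ _ hx hy0
      intro a b c habc
      obtain ⟨h1, h2, h3⟩ := hI0 a (b * r) c (by rw [← habc]; module)
      exact ⟨h1, (mul_eq_zero.1 h2).resolve_right hr, h3⟩
    · exact (σeq _ _ hx0 hx (I3.of_ker ℓ hℓ hx0 hx hx0' ht) t).symm
  have g0 := gne x0 hx0 hx0'
  have inj : ∀ a b : ℝ, a • g x0 = b • g x0 → a = b := fun a b h => smul_left_injective ℝ g0 h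
  let S : ℝ →+* ℝ :=
    { toFun := fun t => σ t x0
      map_one' := inj _ _ (by rw [← hs _ _ hx0, one_smul, one_smul])
      map_zero' := inj _ _ (by rw [← hs _ _ hx0, zero_smul, zero_smul, hg0])
      map_mul' := fun s t => inj _ _ (by
        rw [← hs _ _ hx0, ← smul_smul, hs _ _ (by simp [hx0]), hs _ _ hx0, smul_smul])
      map_add' := fun s t => inj _ _ (by
        rw [← hs _ _ hx0, add_smul, gadd _ _ (by simp [hx0]) (by simp [hx0]), hs _ _ hx0,
          hs _ _ hx0, add_smul]) }
  have hS : ∀ t, σ t x0 = t := fun t => by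
    have : S = RingHom.id ℝ := Subsingleton.elim _ _
    exact congrArg (fun f : ℝ →+* ℝ => f t) this
  have gsmul : ∀ t x, ℓ x = 0 → g (t • x) = t • g x := fun t x hx => by rw [hs t x hx, hS]
  let T : V →ₗ[ℝ] V :=
    { toFun := fun x => ℓ x • Φ e + g (x - ℓ x • e)
      map_add' := fun x y => by
        rw [show x + y - ℓ (x + y) • e = (x - ℓ x • e) + (y - ℓ y • e) by rw [map_add]; module,
          gadd _ _ (by simp [hℓ]) (by simp [hℓ]), map_add]
        module
      map_smul' := fun t x => by
        rw [show t • x - ℓ (t • x) • e = t • (x - ℓ x • e) by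
          rw [map_smul, smul_eq_mul]; module, gsmul _ _ (by simp [hℓ]), map_smul, smul_eq_mul,
          RingHom.id_apply]
        module }
  have hT : ∀ x, T x = ℓ x • Φ e + g (x - ℓ x • e) := fun x => rfl
  have key : ∀ x, ∃ c : ℝ, c ≠ 0 ∧ Φ x = c • T x := by
    intro x
    by_cases hx0 : x = 0
    · exact ⟨1, one_ne_zero, by simp [hx0, hΦ0]⟩
    by_cases hx : ℓ x = 0
    · obtain ⟨⟨b, hb, h2⟩, -⟩ := hg x (I2.of_ker ℓ hℓ hx hx0)
      exact ⟨b, hb, by rw [hT, h2, hx]; simp⟩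
    by_cases hh : x - ℓ x • e = 0
    · refine ⟨1, one_ne_zero, ?_⟩
      rw [hT, hh, hg0, one_smul, add_zero, ← hΦ.smul]
      congr 1
      linear_combination (norm := module) hh
    · have hk : ℓ (x - ℓ x • e) = 0 := by simp [hℓ]
      obtain ⟨-, b, hb, h2⟩ := hg ((ℓ x)⁻¹ • (x - ℓ x • e)) (I2.of_ker ℓ hℓ (by simp [hℓ])
        (smul_ne_zero (inv_ne_zero hx) hh))
      refine ⟨b, hb, ?_⟩
      have hxe : x = ℓ x • (e + (ℓ x)⁻¹ • (x - ℓ x • e)) := by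
        rw [smul_add, smul_smul, mul_inv_cancel₀ hx]; module
      rw [hT]
      conv_lhs => rw [hxe]
      rw [hΦ.smul, h2, gsmul _ _ hk, smul_comm, smul_add, smul_smul, mul_inv_cancel₀ hx, one_smul]
  refine ⟨T, ?_, key⟩
  rw [← LinearMap.ker_eq_bot, LinearMap.ker_eq_bot']
  intro x hx
  by_contra h0
  obtain ⟨c, -, h⟩ := key x
  rw [hx, smul_zero] at h
  exact hΦ.ne x h0 h
end

section
variable {V : Type*} [AddCommGroup V] [Module ℝ V] [FiniteDimensional ℝ V] {Φ : V → V}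

lemma F_finrank (hs : Function.Surjective Φ) (F : Submodule ℝ V → Submodule ℝ V)
    (hF : ∀ U x, Φ x ∈ F U ↔ x ∈ U) : ∀ (k : ℕ) (U : Submodule ℝ V),
    Module.finrank ℝ U + k = Module.finrank ℝ V →
    Module.finrank ℝ (F U) + k ≤ Module.finrank ℝ V := by
  intro k
  induction k with
  | zero => intro U _; simpa using Submodule.finrank_le (F U)
  | succ k ih =>
    intro U hU
    have hne : U ≠ ⊤ := by
      rintro rfl
      rw [finrank_top] at hU; omega
    obtain ⟨x, -, hx⟩ := SetLike.exists_of_lt (lt_top_iff_ne_top.2 hne)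
    have h1 : Module.finrank ℝ (U ⊔ Submodule.span ℝ {x} : Submodule ℝ V)
        = Module.finrank ℝ U + 1 := by
      have hd : Disjoint U (Submodule.span ℝ {x}) := by
        rw [Submodule.disjoint_span_singleton' (by rintro rfl; simp at hx)]
        exact hx
      have hx0 : x ≠ 0 := by rintro rfl; simp at hx
      have := Submodule.finrank_sup_add_finrank_inf_eq U (Submodule.span ℝ {x})
      rw [hd.eq_bot, finrank_bot, finrank_span_singleton hx0] at this
      omega
    have h2 := ih (U ⊔ Submodule.span ℝ {x}) (by omega)
    have hlt : F U < F (U ⊔ Submodule.span ℝ {x}) := by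
      rw [SetLike.lt_iff_le_and_exists]
      constructor
      · intro w hw
        obtain ⟨y, rfl⟩ := hs w
        rw [hF] at hw ⊢
        exact Submodule.mem_sup_left hw
      · refine ⟨Φ x, ?_, ?_⟩
        · rw [hF]; exact Submodule.mem_sup_right (Submodule.mem_span_singleton_self x)
        · rwa [hF]
    have := Submodule.finrank_lt_finrank_of_lt hlt
    omega

lemma I2_iff {x y : V} : I2 x y ↔ LinearIndependent ℝ ![x, y] := by
  rw [LinearIndependent.pair_iff]; rfl

lemma I3_of {x y z : V} (h : I2 x y) (hz : z ∉ Submodule.span ℝ {x, y}) : I3 x y z := by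
  intro a b c habc
  have hc : c = 0 := by
    by_contra hc
    apply hz
    rw [Submodule.mem_span_pair]
    refine ⟨-(c⁻¹ * a), -(c⁻¹ * b), ?_⟩
    have : c⁻¹ • (a • x + b • y + c • z) = c⁻¹ • (0 : V) := by rw [habc]
    rw [smul_add, smul_smul c⁻¹ c, inv_mul_cancel₀ hc, one_smul, smul_zero] at this
    linear_combination (norm := module) -this
  subst hc
  obtain ⟨h1, h2⟩ := h a b (by rw [← habc]; module)
  exact ⟨h1, h2, rfl⟩

lemma I3.notMem {x y z : V} (h : I3 x y z) : z ∉ Submodule.span ℝ {x, y} := by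
  rw [Submodule.mem_span_pair]
  rintro ⟨a, b, hab⟩
  have := (h a b (-1) (by rw [hab]; module)).2.2
  norm_num at this

lemma coll_of (hb : Function.Bijective Φ) (hsm : ∀ (t : ℝ) x, Φ (t • x) = t • Φ x)
    (F : Submodule ℝ V → Submodule ℝ V)
    (hF : ∀ U x, Φ x ∈ F U ↔ x ∈ U) : Coll Φ := by
  have hΦ0 : Φ 0 = 0 := by simpa using hsm 0 0
  have ne : ∀ x, x ≠ 0 → Φ x ≠ 0 := fun x hx h => hx (hb.1 (h.trans hΦ0.symm))
  have i2 : ∀ x y, I2 x y → I2 (Φ x) (Φ y) := by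
    intro x y h a b hab
    have h1 : Φ (a • x) = Φ (-b • y) := by
      rw [hsm, hsm]; linear_combination (norm := module) hab
    have h2 := hb.1 h1
    exact h a b (by rw [h2]; module)
  have span : ∀ x y, I2 x y → F (Submodule.span ℝ {x, y}) = Submodule.span ℝ {Φ x, Φ y} := by
    intro x y h
    have r1 : Module.finrank ℝ (Submodule.span ℝ {x, y}) = 2 := by
      have := finrank_span_eq_card (I2_iff.1 h)
      rw [show Set.range ![x, y] = {x, y} by ext; simp; tauto] at this; simpa using this
    have r2 : Module.finrank ℝ (Submodule.span ℝ {Φ x, Φ y}) = 2 := by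
      have := finrank_span_eq_card (I2_iff.1 (i2 x y h))
      rw [show Set.range ![Φ x, Φ y] = {Φ x, Φ y} by ext; simp; tauto] at this; simpa using this
    have := Submodule.finrank_le (Submodule.span ℝ {x, y})
    have := F_finrank hb.2 F hF (Module.finrank ℝ V - 2) (Submodule.span ℝ {x, y}) (by omega)
    symm
    apply Submodule.eq_of_le_of_finrank_le
    · rw [Submodule.span_le]
      rintro _ (rfl | rfl)
      · exact (hF _ _).2 (Submodule.subset_span (by simp))
      · exact (hF _ _).2 (Submodule.subset_span (by simp))
    · omega
  refine ⟨hsm, i2, ?_, ?_, ne⟩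
  · intro x y z h
    apply I3_of (i2 _ _ h.i12)
    rw [← span _ _ h.i12, hF]
    exact h.notMem
  · intro x y h a b
    have : Φ (a • x + b • y) ∈ F (Submodule.span ℝ {x, y}) := by
      rw [hF, Submodule.mem_span_pair]; exact ⟨a, b, rfl⟩
    rw [span _ _ h, Submodule.mem_span_pair] at this
    obtain ⟨c, d, h⟩ := this
    exact ⟨c, d, h.symm⟩

lemma exists_I3 (hd : 3 ≤ Module.finrank ℝ V) (x y : V) (h : I2 x y) : ∃ z, I3 x y z := by
  have r1 : Module.finrank ℝ (Submodule.span ℝ {x, y}) = 2 := by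
    have := finrank_span_eq_card (I2_iff.1 h)
    rw [show Set.range ![x, y] = {x, y} by ext; simp; tauto] at this; simpa using this
  have hne : Submodule.span ℝ {x, y} ≠ ⊤ := by
    intro h; rw [h, finrank_top] at r1; omega
  obtain ⟨z, -, hz⟩ := SetLike.exists_of_lt (lt_top_iff_ne_top.2 hne)
  exact ⟨z, I3_of h hz⟩

lemma exists_I2 (hd : 3 ≤ Module.finrank ℝ V) (x : V) (h : x ≠ 0) : ∃ z, I2 x z := by
  have r1 := finrank_span_singleton (K := ℝ) h
  have hne : Submodule.span ℝ {x} ≠ ⊤ := by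
    intro h; rw [h, finrank_top] at r1; omega
  obtain ⟨z, -, hz⟩ := SetLike.exists_of_lt (lt_top_iff_ne_top.2 hne)
  refine ⟨z, I2_iff.2 ?_⟩
  rw [LinearIndependent.pair_iff' h]
  intro a ha
  exact hz (Submodule.mem_span_singleton.2 ⟨a, ha⟩)
end

open scoped RealInnerProductSpace Manifold
open Metric

lemma sphere_main {E : Type*} [NormedAddCommGroup E] [InnerProductSpace ℝ E]
    [FiniteDimensional ℝ E] (hd : 3 ≤ Module.finrank ℝ E)
    (φ : sphere (0 : E) 1 → sphere (0 : E) 1) (hc : Continuous φ) (hb : Function.Bijective φ)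
    (h : ∀ v : E, v ≠ 0 → ∃ w : E, w ≠ 0 ∧
      φ '' {x : sphere (0 : E) 1 | ⟪(x : E), v⟫ = 0} = {x : sphere (0 : E) 1 | ⟪(x : E), w⟫ = 0}) :
    ∃ T : E →ₗ[ℝ] E, Function.Bijective T ∧
      ∀ x : sphere (0 : E) 1, (φ x : E) = ‖T (x : E)‖⁻¹ • T (x : E) := by
  have hh : ∀ v : E, ∃ w : E, ∀ s : sphere (0 : E) 1, ⟪(φ s : E), w⟫ = 0 ↔ ⟪(s : E), v⟫ = 0 := by
    intro v
    by_cases hv : v = 0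
    · exact ⟨0, fun s => by simp [hv]⟩
    obtain ⟨w, -, hw⟩ := h v hv
    refine ⟨w, fun s => ?_⟩
    have := hb.1.mem_set_image (s := {x : sphere (0 : E) 1 | ⟪(x : E), v⟫ = 0}) (a := s)
    rw [hw] at this
    exact this
  choose W hW using hh
  let F : Submodule ℝ E → Submodule ℝ E := fun U => ⨅ v ∈ Uᗮ, (Submodule.span ℝ {W v})ᗮ
  have hF : ∀ U (s : sphere (0 : E) 1), (φ s : E) ∈ F U ↔ (s : E) ∈ U := by
    intro U s
    simp only [F, Submodule.mem_iInf, Submodule.mem_orthogonal_singleton_iff_inner_left, hW]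
    conv_rhs => rw [← Submodule.orthogonal_orthogonal U]
    rw [Submodule.mem_orthogonal']
  have sn : ∀ s : sphere (0 : E) 1, ‖(s : E)‖ = 1 := fun s => by simp
  have s0 : ∀ s : sphere (0 : E) 1, (s : E) ≠ 0 := fun s h => by
    have := sn s; rw [h] at this; simp at this
  have odd : ∀ s, φ (-s) = - φ s := by
    intro s
    obtain ⟨y, hy⟩ := hb.2 (-φ s)
    have h1 : (y : E) ∈ Submodule.span ℝ {(s : E)} := by
      rw [← hF, hy]
      have : (φ s : E) ∈ F (Submodule.span ℝ {(s : E)}) :=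
        (hF _ _).2 (Submodule.mem_span_singleton_self _)
      simpa using this
    obtain ⟨a, ha⟩ := Submodule.mem_span_singleton.1 h1
    have h2 : |a| = 1 := by
      have := congrArg norm ha
      simpa [norm_smul, sn] using this
    rcases eq_or_eq_neg_of_abs_eq h2 with rfl | rfl
    · exfalso
      have : y = s := Subtype.ext (by simpa using ha.symm)
      rw [this] at hy
      have h3 : (φ s : E) = -(φ s : E) := congrArg Subtype.val hy
      have h4 : (2 : ℝ) • (φ s : E) = 0 := by linear_combination (norm := module) h3
      exact s0 (φ s) ((smul_eq_zero.1 h4).resolve_left two_ne_zero)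
    · have : y = -s := Subtype.ext (by simpa using ha.symm)
      rw [← this, hy]
  let N : ∀ x : E, x ≠ 0 → sphere (0 : E) 1 := fun x hx =>
    ⟨‖x‖⁻¹ • x, by simp [norm_smul, hx]⟩
  classical
  let Φ : E → E := fun x => if hx : x = 0 then 0 else ‖x‖ • (φ (N x hx) : E)
  have hΦ0 : Φ 0 = 0 := by simp [Φ]
  have hΦs : ∀ (r : ℝ) (s : sphere (0 : E) 1), 0 < r → Φ (r • (s : E)) = r • (φ s : E) := by
    intro r s hr
    have hx : r • (s : E) ≠ 0 := smul_ne_zero hr.ne' (s0 s)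
    have hn : ‖r • (s : E)‖ = r := by rw [norm_smul, sn, mul_one, Real.norm_of_nonneg hr.le]
    have hN : N _ hx = s := Subtype.ext (by
      simp only [N]; rw [hn, smul_smul, inv_mul_cancel₀ hr.ne', one_smul])
    simp only [Φ, hx, dif_neg, not_false_eq_true, hN, hn]
  have hpol : ∀ x : E, x ≠ 0 → ∃ (r : ℝ) (s : sphere (0 : E) 1), 0 < r ∧ x = r • (s : E) := by
    intro x hx
    have : 0 < ‖x‖ := norm_pos_iff.2 hx
    exact ⟨‖x‖, N x hx, this, by simp only [N]; rw [smul_smul, mul_inv_cancel₀ this.ne', one_smul]⟩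
  have hsm : ∀ (t : ℝ) x, Φ (t • x) = t • Φ x := by
    intro t x
    by_cases hx : x = 0
    · simp [hx, hΦ0]
    obtain ⟨r, s, hr, rfl⟩ := hpol x hx
    rcases lt_trichotomy t 0 with ht | rfl | ht
    · rw [show t • r • (s : E) = (-t * r) • ((-s : sphere (0 : E) 1) : E) by
        rw [coe_neg_sphere]; module, hΦs _ _ (by nlinarith), hΦs _ _ hr, odd, coe_neg_sphere]
      module
    · simp [hΦ0]
    · rw [smul_smul, hΦs _ _ (by positivity), hΦs _ _ hr, smul_smul]
  have hbij : Function.Bijective Φ := by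
    constructor
    · intro x y hxy
      by_cases hx : x = 0
      · subst hx
        by_contra hy
        obtain ⟨r, s, hr, rfl⟩ := hpol y (Ne.symm hy)
        rw [hΦ0, hΦs _ _ hr] at hxy
        exact smul_ne_zero hr.ne' (s0 _) hxy.symm
      obtain ⟨r, s, hr, rfl⟩ := hpol x hx
      by_cases hy : y = 0
      · rw [hy, hΦ0, hΦs _ _ hr] at hxy
        exact absurd hxy (smul_ne_zero hr.ne' (s0 _))
      obtain ⟨r', s', hr', rfl⟩ := hpol y hy
      rw [hΦs _ _ hr, hΦs _ _ hr'] at hxy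
      have h1 : r = r' := by
        have := congrArg norm hxy
        simpa [norm_smul, sn, abs_of_pos hr, abs_of_pos hr'] using this
      subst h1
      have h2 := hb.1 (Subtype.ext (smul_right_injective E hr.ne' hxy))
      rw [h2]
    · intro y
      by_cases hy : y = 0
      · exact ⟨0, by rw [hΦ0, hy]⟩
      obtain ⟨r', s', hr', rfl⟩ := hpol y hy
      obtain ⟨s, rfl⟩ := hb.2 s'
      exact ⟨r' • s, hΦs _ _ hr'⟩
  have hF' : ∀ U x, Φ x ∈ F U ↔ x ∈ U := by
    intro U x
    by_cases hx : x = 0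
    · simp [hx, hΦ0]
    obtain ⟨r, s, hr, rfl⟩ := hpol x hx
    rw [hΦs _ _ hr, Submodule.smul_mem_iff _ hr.ne', Submodule.smul_mem_iff _ hr.ne', hF]
  have hC := coll_of hbij hsm F hF'
  have : Nontrivial E := Module.nontrivial_of_finrank_pos (R := ℝ) (by omega)
  obtain ⟨e, he⟩ := exists_norm_eq (E := E) (zero_le_one)
  have he0 : e ≠ 0 := by rintro rfl; simp at he
  obtain ⟨T, hTi, hT⟩ := ftpg hC e (innerₛₗ ℝ e) (by simp [he])
    (fun x y => exists_I3 hd x y) (exists_I2 hd e he0)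
  have hTc : Continuous T := T.continuous_of_finiteDimensional
  have hT' : ∀ s : sphere (0 : E) 1, ∃ c : ℝ, c ≠ 0 ∧ (φ s : E) = c • T s := by
    intro s
    obtain ⟨c, hc, h⟩ := hT s
    have := hΦs 1 s one_pos
    rw [one_smul, one_smul] at this
    exact ⟨c, hc, this ▸ h⟩
  have T0 : ∀ s : sphere (0 : E) 1, T s ≠ 0 := fun s h => s0 s (hTi (by rw [h, map_zero]))
  have fin : ∀ (T : E →ₗ[ℝ] E) (s : sphere (0 : E) 1) (c : ℝ), 0 < c → (φ s : E) = c • T s →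
      (φ s : E) = ‖T (s : E)‖⁻¹ • T (s : E) := by
    intro T s c hc h
    have := congrArg norm h
    rw [sn, norm_smul, Real.norm_of_nonneg hc.le] at this
    rw [h, eq_inv_of_mul_eq_one_left this.symm]
  have hf : Continuous (fun s : sphere (0 : E) 1 => ⟪(φ s : E), T s⟫) := by fun_prop
  have hconn : PreconnectedSpace (sphere (0 : E) 1) :=
    Subtype.preconnectedSpace (isPreconnected_sphere (by
      rw [← Module.finrank_eq_rank]; exact_mod_cast (by omega : 1 < Module.finrank ℝ E)) 0 1)
  have hbijT : Function.Bijective T := ⟨hTi, LinearMap.injective_iff_surjective.1 hTi⟩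
  have fval : ∀ (s : sphere (0 : E) 1) (c : ℝ), (φ s : E) = c • T s →
      ⟪(φ s : E), T s⟫ = c * ‖T s‖ ^ 2 := by
    intro s c h
    rw [h, real_inner_smul_left, real_inner_self_eq_norm_sq]
  have fne : ∀ s : sphere (0 : E) 1, ⟪(φ s : E), T s⟫ ≠ 0 := by
    intro s
    obtain ⟨c, hc, h⟩ := hT' s
    rw [fval s c h]
    have := norm_ne_zero_iff.2 (T0 s)
    positivity
  by_cases hpos : ∀ s : sphere (0 : E) 1, 0 < ⟪(φ s : E), T s⟫
  · refine ⟨T, hbijT, fun s => ?_⟩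
    obtain ⟨c, hc, h⟩ := hT' s
    have h1 := hpos s
    rw [fval s c h] at h1
    exact fin T s c (pos_of_mul_pos_left h1 (by positivity)) h
  · push Not at hpos
    obtain ⟨s1, h1⟩ := hpos
    have hneg : ∀ s : sphere (0 : E) 1, ⟪(φ s : E), T s⟫ < 0 := by
      intro s
      by_contra h2
      push Not at h2
      obtain ⟨s3, h3⟩ := mem_range_of_exists_le_of_exists_ge hf ⟨s1, h1⟩ ⟨s, h2⟩
      exact fne s3 h3
    refine ⟨-T, ?_, fun s => ?_⟩
    · exact (Equiv.neg E).bijective.comp hbijT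
    · obtain ⟨c, hc, h⟩ := hT' s
      have h1 := hneg s
      rw [fval s c h] at h1
      have hc' : 0 < -c := by
        by_contra h4
        have : 0 ≤ c * ‖T s‖ ^ 2 := mul_nonneg (by linarith) (by positivity)
        linarith
      exact fin (-T) s (-c) hc' (by rw [h]; simp)


/-- Let `n ≥ 2`. A diffeomorphism of the unit sphere `Sⁿ ⊂ ℝ^{n+1}` mapping every
equator onto an equator is of the form `x ↦ T x / ‖T x‖` for some invertible linear map
`T` of `ℝ^{n+1}`. -/
theorem stmt8 (n : ℕ) (hn : 2 ≤ n)
    [Fact (Module.finrank ℝ (EuclideanSpace ℝ (Fin (n + 1))) = n + 1)]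
    (φ : Diffeomorph (𝓡 n) (𝓡 n)
      (sphere (0 : EuclideanSpace ℝ (Fin (n + 1))) 1)
      (sphere (0 : EuclideanSpace ℝ (Fin (n + 1))) 1) (⊤ : ℕ∞))
    (h : ∀ v : EuclideanSpace ℝ (Fin (n + 1)), v ≠ 0 →
      ∃ w : EuclideanSpace ℝ (Fin (n + 1)), w ≠ 0 ∧
        (⇑φ) '' {x : sphere (0 : EuclideanSpace ℝ (Fin (n + 1))) 1 |
            ⟪(x : EuclideanSpace ℝ (Fin (n + 1))), v⟫ = 0}
          = {x : sphere (0 : EuclideanSpace ℝ (Fin (n + 1))) 1 |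
            ⟪(x : EuclideanSpace ℝ (Fin (n + 1))), w⟫ = 0}) :
    ∃ T : EuclideanSpace ℝ (Fin (n + 1)) →ₗ[ℝ] EuclideanSpace ℝ (Fin (n + 1)),
      Function.Bijective T ∧
      ∀ x : sphere (0 : EuclideanSpace ℝ (Fin (n + 1))) 1,
        (φ x : EuclideanSpace ℝ (Fin (n + 1)))
          = ‖T (x : EuclideanSpace ℝ (Fin (n + 1)))‖⁻¹ • T (x : EuclideanSpace ℝ (Fin (n + 1))) := by
  exact sphere_main (by rw [finrank_euclideanSpace_fin]; omega) φ φ.continuous φ.bijective h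
end

section
/- Let T ∈ GL(n+1,ℝ), let φ(T) : S^n → S^n be the map φ(T)(x) = T(x)/|T(x)|, and let μ denote the n-dimensional Hausdorff measure restricted to the unit sphere S^n ⊂ ℝ^{n+1}. Then the pushforward under φ(T) of the measure with density p ↦ |det T|/|Tp|^{n+1} with respect to μ equals μ; that is, for every measurable set A ⊆ S^n, μ(φ(T)(A)) = ∫_A |det T|/|Tp|^{n+1} dμ(p). (This is the Jacobian formula φ(T)*dV_ḡ = (det T/|Tp|^{n+1}) dV_ḡ for the round volume element.) -/
open scoped RealInnerProductSpace
open MeasureTheory Metric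

lemma aux_half {E : Type*} [MetricSpace E] [MeasurableSpace E] [BorelSpace E]
    [SecondCountableTopology E] (μ ν : Measure E) [IsFiniteMeasure μ] [IsFiniteMeasure ν]
    (S : Set E) (hμS : ∀ᵐ x ∂μ, x ∈ S) (hνS : ∀ᵐ x ∂ν, x ∈ S) (g h : ℝ → ENNReal)
    (hg : ∀ x ∈ S, ∀ r, μ (ball x r) = g r) (hh : ∀ x ∈ S, ∀ r, ν (ball x r) = h r)
    (h0 : ∀ r, 0 < r → h r ≠ 0) (ht : ∀ r, h r ≠ ⊤) (U : Set E) (hU : IsOpen U) :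
    μ U ≤ Filter.liminf (fun k : ℕ => (h (1 / ((k : ℝ) + 1)))⁻¹ * g (1 / ((k : ℝ) + 1)) * ν U)
      Filter.atTop := by
  have hms : ∀ r : ℝ, MeasurableSet {p : E × E | p.2 ∈ U ∧ dist p.2 p.1 < r} := by
    intro r
    apply IsOpen.measurableSet
    exact (hU.preimage continuous_snd).inter
      (isOpen_lt (continuous_snd.dist continuous_fst) continuous_const)
  have hmeas : ∀ r : ℝ, Measurable fun x => ν (U ∩ ball x r) := by
    intro r
    exact measurable_measure_prodMk_left (hms r)
  have hfub : ∀ r : ℝ, ∫⁻ x, ν (U ∩ ball x r) ∂μ = g r * ν U := by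
    intro r
    have h1 := Measure.prod_apply (μ := μ) (ν := ν) (hms r)
    have h2 := Measure.prod_apply_symm (μ := μ) (ν := ν) (hms r)
    have h3 : ∫⁻ x, ν (U ∩ ball x r) ∂μ = ∫⁻ x, ν (Prod.mk x ⁻¹' {p : E × E | p.2 ∈ U ∧ dist p.2 p.1 < r}) ∂μ := rfl
    rw [h3, ← h1, h2]
    have h4 : ∀ᵐ y ∂ν, μ ((fun x => (x, y)) ⁻¹' {p : E × E | p.2 ∈ U ∧ dist p.2 p.1 < r})
        = U.indicator (fun _ => g r) y := by
      filter_upwards [hνS] with y hy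
      by_cases hyU : y ∈ U
      · simp only [Set.indicator_of_mem hyU]
        rw [← hg y hy r]
        congr 1
        ext x
        simp [hyU, dist_comm]
      · simp [hyU]
    rw [lintegral_congr_ae h4, lintegral_indicator_const hU.measurableSet]
  calc μ U = ∫⁻ x in U, 1 ∂μ := by simp
    _ ≤ ∫⁻ x in U, Filter.liminf (fun k : ℕ => (h (1 / ((k : ℝ) + 1)))⁻¹ *
          ν (U ∩ ball x (1 / ((k : ℝ) + 1)))) Filter.atTop ∂μ := by
        apply lintegral_mono_ae
        filter_upwards [ae_restrict_mem hU.measurableSet, ae_restrict_of_ae hμS] with x hx hxS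
        obtain ⟨ε, hε, hb⟩ := Metric.isOpen_iff.1 hU x hx
        apply Filter.le_liminf_of_le
        · isBoundedDefault
        have := (tendsto_one_div_add_atTop_nhds_zero_nat (𝕜 := ℝ)).eventually (gt_mem_nhds hε)
        filter_upwards [this] with k hk
        rw [Set.inter_eq_self_of_subset_right ((ball_subset_ball hk.le).trans hb), hh x hxS,
          ENNReal.inv_mul_cancel (h0 _ (by positivity)) (ht _)]
    _ ≤ Filter.liminf (fun k : ℕ => ∫⁻ x in U, (h (1 / ((k : ℝ) + 1)))⁻¹ *
          ν (U ∩ ball x (1 / ((k : ℝ) + 1))) ∂μ) Filter.atTop :=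
        lintegral_liminf_le fun k => (hmeas _).const_mul _
    _ ≤ _ := by
        apply Filter.liminf_le_liminf
        · refine Filter.Eventually.of_forall fun k => ?_
          rw [lintegral_const_mul _ (hmeas _), mul_assoc, ← hfub]
          gcongr
          exact Measure.restrict_le_self
        · isBoundedDefault
        · isBoundedDefault

lemma aux_le {E : Type*} [MetricSpace E] [MeasurableSpace E] [BorelSpace E]
    [SecondCountableTopology E] (μ ν : Measure E) [IsFiniteMeasure μ] [IsFiniteMeasure ν]
    (S : Set E) (hμS : ∀ᵐ x ∂μ, x ∈ S) (hνS : ∀ᵐ x ∂ν, x ∈ S) (g h : ℝ → ENNReal)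
    (hg : ∀ x ∈ S, ∀ r, μ (ball x r) = g r) (hh : ∀ x ∈ S, ∀ r, ν (ball x r) = h r)
    (h0 : ∀ r, 0 < r → h r ≠ 0) (ht : ∀ r, h r ≠ ⊤)
    (g0 : ∀ r, 0 < r → g r ≠ 0) (gt : ∀ r, g r ≠ ⊤) (U : Set E) (hU : IsOpen U) :
    μ U * ν Set.univ ≤ ν U * μ Set.univ := by
  have h1 := aux_half μ ν S hμS hνS g h hg hh h0 ht U hU
  have h2 := aux_half ν μ S hνS hμS h g hh hg g0 gt _ isOpen_univ
  refine (mul_le_mul' h1 h2).trans ((ENNReal.le_liminf_mul).trans ?_)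
  have : ((fun k : ℕ => (h (1 / ((k : ℝ) + 1)))⁻¹ * g (1 / ((k : ℝ) + 1)) * ν U) *
      (fun k : ℕ => (g (1 / ((k : ℝ) + 1)))⁻¹ * h (1 / ((k : ℝ) + 1)) * μ Set.univ)) =
      fun _ => ν U * μ Set.univ := by
    funext k
    have hk : (0:ℝ) < 1 / ((k : ℝ) + 1) := by positivity
    simp only [Pi.mul_apply]
    calc _ = ((h (1 / ((k : ℝ) + 1)))⁻¹ * h (1 / ((k : ℝ) + 1))) *
          ((g (1 / ((k : ℝ) + 1)))⁻¹ * g (1 / ((k : ℝ) + 1))) * (ν U * μ Set.univ) := by ring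
      _ = _ := by
        rw [ENNReal.inv_mul_cancel (h0 _ hk) (ht _), ENNReal.inv_mul_cancel (g0 _ hk) (gt _)]
        simp
  rw [this]
  simp

lemma aux_prop {E : Type*} [MetricSpace E] [MeasurableSpace E] [BorelSpace E]
    [SecondCountableTopology E] (μ ν : Measure E) [IsFiniteMeasure μ] [IsFiniteMeasure ν]
    (S : Set E) (hμS : ∀ᵐ x ∂μ, x ∈ S) (hνS : ∀ᵐ x ∂ν, x ∈ S)
    (hg : ∀ x ∈ S, ∀ y ∈ S, ∀ r, μ (ball x r) = μ (ball y r))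
    (hh : ∀ x ∈ S, ∀ y ∈ S, ∀ r, ν (ball x r) = ν (ball y r)) (hν : ν ≠ 0) :
    ∃ c : ENNReal, μ = c • ν := by
  by_cases hμ : μ = 0
  · exact ⟨0, by simp [hμ]⟩
  have key : ∀ (ρ : Measure E), ρ ≠ 0 → (∀ᵐ x ∂ρ, x ∈ S) →
      (∀ x ∈ S, ∀ y ∈ S, ∀ r, ρ (ball x r) = ρ (ball y r)) →
      ∀ y ∈ S, ∀ r, 0 < r → ρ (ball y r) ≠ 0 := by
    intro ρ hρ hS hu y hy r hr
    have hS0 : ρ S ≠ 0 := by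
      intro h0
      apply hρ
      rw [← Measure.measure_univ_eq_zero, ← Set.union_compl_self S]
      exact measure_union_null h0 hS
    obtain ⟨x, hx, hp⟩ := exists_mem_forall_mem_nhdsWithin_pos_measure hS0
    rw [hu y hy x hx]
    exact (hp _ (mem_nhdsWithin_of_mem_nhds (ball_mem_nhds x hr))).ne'
  have hSne : S.Nonempty := by
    by_contra hne
    rw [Set.not_nonempty_iff_eq_empty] at hne
    subst hne
    apply hμ
    rw [← Measure.measure_univ_eq_zero]
    have := hμS
    rw [ae_iff] at this
    simpa using this
  obtain ⟨x, hx⟩ := hSne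
  have hle := aux_le μ ν S hμS hνS (fun r => μ (ball x r)) (fun r => ν (ball x r))
    (fun y hy r => hg y hy x hx r) (fun y hy r => hh y hy x hx r)
    (key ν hν hνS hh x hx) (fun r => measure_ne_top _ _)
    (key μ hμ hμS hg x hx) (fun r => measure_ne_top _ _)
  have hge := aux_le ν μ S hνS hμS (fun r => ν (ball x r)) (fun r => μ (ball x r))
    (fun y hy r => hh y hy x hx r) (fun y hy r => hg y hy x hx r)
    (key μ hμ hμS hg x hx) (fun r => measure_ne_top _ _)
    (key ν hν hνS hh x hx) (fun r => measure_ne_top _ _)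
  have hu0 : ν Set.univ ≠ 0 := by simpa using hν
  have hut : ν Set.univ ≠ ⊤ := measure_ne_top _ _
  refine ⟨μ Set.univ * (ν Set.univ)⁻¹, ?_⟩
  have hopen : ∀ U, IsOpen U → μ U = ((μ Set.univ * (ν Set.univ)⁻¹) • ν) U := by
    intro U hU
    have e := le_antisymm (hle U hU) (hge U hU)
    simp only [Measure.smul_apply, smul_eq_mul]
    calc μ U = μ U * ν Set.univ * (ν Set.univ)⁻¹ := by
          rw [mul_assoc, ENNReal.mul_inv_cancel hu0 hut, mul_one]
      _ = _ := by rw [e]; ring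
  refine ext_of_generate_finite {U | IsOpen U} (BorelSpace.measurable_eq) isPiSystem_isOpen
    (fun U hU => hopen U hU) (hopen _ isOpen_univ)

lemma aux_finite (n : ℕ) :
    (μH[(n : ℝ)] : Measure (EuclideanSpace ℝ (Fin (n + 1)))) (sphere 0 1) < ⊤ := by
  have hemi : ∀ v : EuclideanSpace ℝ (Fin (n + 1)), ‖v‖ = 1 →
      (μH[(n : ℝ)] : Measure (EuclideanSpace ℝ (Fin (n + 1))))
        {x | x ∈ sphere 0 1 ∧ inner ℝ v x ≤ 0} < ⊤ := by
    intro v hv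
    let F := (Submodule.span ℝ {v})ᗮ
    have hfr : Module.finrank ℝ F = n := by
      have : Fact (Module.finrank ℝ (EuclideanSpace ℝ (Fin (n + 1))) = n + 1) := ⟨by simp⟩
      exact Submodule.finrank_orthogonal_span_singleton (by rintro rfl; simp at hv)
    let f : F → EuclideanSpace ℝ (Fin (n + 1)) := fun w => stereoInvFunAux v (w : EuclideanSpace ℝ (Fin (n + 1)))
    have hf : ContDiff ℝ 1 f := contDiff_stereoInvFunAux.comp F.subtypeL.contDiff
    have hL : LocallyLipschitz f := hf.locallyLipschitz
    obtain ⟨K, hK⟩ := (hL.locallyLipschitzOn (s := closedBall 0 2)).exists_lipschitzOnWith_of_compact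
      (isCompact_closedBall 0 2)
    have hH : (μH[(n : ℝ)] : Measure F) (closedBall 0 2) < ⊤ := by
      have : (μH[(Module.finrank ℝ F : ℝ)] : Measure F) (closedBall 0 2) < ⊤ :=
        (isCompact_closedBall 0 2).measure_lt_top
      rwa [hfr] at this
    have hsub : {x | x ∈ sphere 0 1 ∧ inner ℝ v x ≤ 0} ⊆ f '' closedBall 0 2 := by
      rintro x ⟨hx, hvx⟩
      have hxv : x ≠ v := by
        rintro rfl
        rw [real_inner_self_eq_norm_sq, hv] at hvx
        norm_num at hvx
      refine ⟨stereoToFun v x, ?_, ?_⟩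
      · rw [mem_closedBall_zero_iff, stereoToFun_apply, norm_smul]
        have h1 : ‖(Submodule.span ℝ {v})ᗮ.orthogonalProjectionOnto x‖ ≤ 1 := by
          refine (Submodule.norm_orthogonalProjectionOnto_apply_le _ _).trans ?_
          simpa using hx.le
        have h2 : ‖(2 / ((1 : ℝ) - innerSL ℝ v x))‖ ≤ 2 := by
          rw [Real.norm_eq_abs, innerSL_apply_apply, abs_of_nonneg (by apply div_nonneg <;> linarith),
            div_le_iff₀ (by linarith)]
          linarith
        nlinarith [norm_nonneg ((Submodule.span ℝ {v})ᗮ.orthogonalProjectionOnto x)]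
      · exact congrArg Subtype.val (stereo_left_inv hv (x := ⟨x, hx⟩) hxv)
    refine (measure_mono hsub).trans_lt ((hK.hausdorffMeasure_image_le (by positivity)).trans_lt ?_)
    exact ENNReal.mul_lt_top (ENNReal.rpow_lt_top_of_nonneg (by positivity) (by simp)) hH
  obtain ⟨v, hv⟩ : ∃ v : EuclideanSpace ℝ (Fin (n + 1)), ‖v‖ = 1 := exists_norm_eq _ zero_le_one
  refine (measure_mono (t := {x | x ∈ sphere 0 1 ∧ inner ℝ v x ≤ 0} ∪
    {x | x ∈ sphere 0 1 ∧ inner ℝ (-v) x ≤ 0}) ?_).trans_lt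
    (measure_union_lt_top (hemi v hv) (hemi (-v) (by simpa using hv)))
  intro x hx
  rcases le_total (inner ℝ v x) 0 with h | h
  · exact Or.inl ⟨hx, h⟩
  · exact Or.inr ⟨hx, by simpa using h⟩

open scoped Pointwise in
lemma aux_nu_apply (n : ℕ) (B : Set (EuclideanSpace ℝ (Fin (n + 1)))) (hB : MeasurableSet B) :
    ((volume : Measure (EuclideanSpace ℝ (Fin (n + 1)))).toSphere.map Subtype.val) B
      = ((n + 1 : ℕ) : ENNReal) * volume (Set.Ioo (0 : ℝ) 1 • (B ∩ sphere 0 1)) := by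
  rw [Measure.map_apply measurable_subtype_coe hB,
    Measure.toSphere_apply' _ (measurable_subtype_coe hB), Subtype.image_preimage_coe,
    finrank_euclideanSpace_fin, Set.inter_comm]

lemma aux_exists_rot {E : Type*} [NormedAddCommGroup E] [InnerProductSpace ℝ E] (x y : E)
    (hx : x ∈ sphere (0 : E) 1) (hy : y ∈ sphere (0 : E) 1) (r : ℝ) :
    ∃ L : E ≃ₗᵢ[ℝ] E, ball y r ∩ sphere 0 1 = L '' (ball x r ∩ sphere 0 1) := by
  refine ⟨Submodule.reflection (Submodule.span ℝ {x - y})ᗮ, ?_⟩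
  have hxy : Submodule.reflection (Submodule.span ℝ {x - y})ᗮ x = y :=
    Submodule.reflection_sub (by simp_all)
  rw [Set.image_inter (LinearIsometryEquiv.injective _), LinearIsometryEquiv.image_ball,
    LinearIsometryEquiv.image_sphere, hxy, map_zero]

open scoped Pointwise in
lemma aux_prop_sphere (n : ℕ) : ∃ c : ENNReal,
    (μH[(n : ℝ)].restrict (sphere (0 : EuclideanSpace ℝ (Fin (n + 1))) 1)) =
      c • ((volume : Measure (EuclideanSpace ℝ (Fin (n + 1)))).toSphere.map Subtype.val) := by
  have : IsFiniteMeasure (μH[(n : ℝ)].restrict (sphere (0 : EuclideanSpace ℝ (Fin (n + 1))) 1)) :=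
    ⟨by simpa using aux_finite n⟩
  apply aux_prop _ _ (sphere (0 : EuclideanSpace ℝ (Fin (n + 1))) 1)
  · exact ae_restrict_mem isClosed_sphere.measurableSet
  · refine (ae_map_iff measurable_subtype_coe.aemeasurable
      (p := fun x => x ∈ sphere (0 : EuclideanSpace ℝ (Fin (n + 1))) 1)
      isClosed_sphere.measurableSet).2 ?_
    exact Filter.Eventually.of_forall fun x => x.2
  · intro x hx y hy r
    obtain ⟨L, hL⟩ := aux_exists_rot x y hx hy r
    rw [Measure.restrict_apply measurableSet_ball, Measure.restrict_apply measurableSet_ball, hL,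
      L.isometry.hausdorffMeasure_image (Or.inl (by positivity))]
  · intro x hx y hy r
    obtain ⟨L, hL⟩ := aux_exists_rot x y hx hy r
    rw [aux_nu_apply _ _ measurableSet_ball, aux_nu_apply _ _ measurableSet_ball, hL]
    congr 1
    have : Set.Ioo (0 : ℝ) 1 • (L '' (ball x r ∩ sphere 0 1)) =
        L '' (Set.Ioo (0 : ℝ) 1 • (ball x r ∩ sphere 0 1)) := by
      rw [← Set.image2_smul, ← Set.image2_smul, Set.image_image2, Set.image2_image_right]
      simp
    rw [this]
    have h := L.measurePreserving.measure_preimage_equiv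
      (f := L.toMeasurableEquiv) (L '' (Set.Ioo (0 : ℝ) 1 • (ball x r ∩ sphere 0 1)))
    rw [← h]
    congr 1
    exact (Set.preimage_image_eq _ L.injective).symm
  · intro h
    have h1 : ((volume : Measure (EuclideanSpace ℝ (Fin (n + 1)))).toSphere) ≠ 0 :=
      Measure.toSphere_ne_zero _
    exact h1 ((Measure.map_eq_zero_iff measurable_subtype_coe.aemeasurable).1 h)

open scoped Pointwise in
lemma aux_jac (n : ℕ)
    (T : EuclideanSpace ℝ (Fin (n + 1)) ≃ₗ[ℝ] EuclideanSpace ℝ (Fin (n + 1)))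
    (A : Set (EuclideanSpace ℝ (Fin (n + 1))))
    (hA : A ⊆ sphere (0 : EuclideanSpace ℝ (Fin (n + 1))) 1)
    (hAm : MeasurableSet A) :
    ((volume : Measure (EuclideanSpace ℝ (Fin (n + 1)))).toSphere.map Subtype.val)
        ((fun x => ‖T x‖⁻¹ • (T x)) '' A)
      = ∫⁻ p in A,
          ENNReal.ofReal
            (|LinearMap.det (T : EuclideanSpace ℝ (Fin (n + 1)) →ₗ[ℝ]
                EuclideanSpace ℝ (Fin (n + 1)))| / ‖T p‖ ^ (n + 1))
          ∂((volume : Measure (EuclideanSpace ℝ (Fin (n + 1)))).toSphere.map Subtype.val) := by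
  have hTc : Continuous T := T.toLinearMap.continuous_of_finiteDimensional
  have hTsc : Continuous T.symm := T.symm.toLinearMap.continuous_of_finiteDimensional
  have hne : ∀ x ∈ sphere (0 : EuclideanSpace ℝ (Fin (n + 1))) 1, x ≠ 0 := by
    rintro x hx rfl
    simp at hx
  have hTpos : ∀ x ≠ 0, 0 < ‖T x‖ := fun x hx => norm_pos_iff.2 (by simpa using hx)
  have himg : (fun x => ‖T x‖⁻¹ • (T x)) '' A =
      sphere 0 1 ∩ (fun y => ‖T.symm y‖⁻¹ • T.symm y) ⁻¹' A := by
    ext y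
    constructor
    · rintro ⟨x, hx, rfl⟩
      have hx0 := hne x (hA hx)
      have hp := hTpos x hx0
      have hx1 : ‖x‖ = 1 := by simpa using hA hx
      refine ⟨by simp [norm_smul, hp.ne'], ?_⟩
      simp only [Set.mem_preimage, map_smul, LinearEquiv.symm_apply_apply, norm_smul, norm_inv,
        norm_norm, hx1, mul_one, inv_inv, smul_smul, mul_inv_cancel₀ hp.ne', one_smul, hx]
    · rintro ⟨hy, hyA⟩
      have hy1 : ‖y‖ = 1 := by simpa using hy
      have hy0 := hne y hy
      have hp : 0 < ‖T.symm y‖ := norm_pos_iff.2 (by simpa using hy0)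
      refine ⟨_, hyA, ?_⟩
      simp only [map_smul, LinearEquiv.apply_symm_apply, norm_smul, norm_inv,
        norm_norm, hy1, mul_one, inv_inv, smul_smul, mul_inv_cancel₀ hp.ne', one_smul]
  have hBm : MeasurableSet ((fun x => ‖T x‖⁻¹ • (T x)) '' A) := by
    rw [himg]
    refine isClosed_sphere.measurableSet.inter (?_ : MeasurableSet _)
    have : Measurable (fun y => ‖T.symm y‖⁻¹ • T.symm y) :=
      (hTsc.measurable.norm.inv).smul hTsc.measurable
    exact this hAm
  have hBS : (fun x => ‖T x‖⁻¹ • (T x)) '' A ⊆ sphere 0 1 := by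
    rw [himg]; exact Set.inter_subset_left
  rw [aux_nu_apply _ _ hBm, Set.inter_eq_self_of_subset_left hBS]
  let P : Set (sphere (0 : EuclideanSpace ℝ (Fin (n + 1))) 1 × Set.Ioi (0 : ℝ)) :=
    {q | (q.1 : EuclideanSpace ℝ (Fin (n + 1))) ∈ A ∧ (q.2 : ℝ) < ‖T q.1‖⁻¹}
  have hPm : MeasurableSet P := by
    refine MeasurableSet.inter (?_ : MeasurableSet _) (?_ : MeasurableSet _)
    · exact (measurable_subtype_coe.comp measurable_fst) hAm
    · exact measurableSet_lt (measurable_subtype_coe.comp measurable_snd)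
        ((hTc.measurable.comp (measurable_subtype_coe.comp measurable_fst)).norm.inv)
  have hcone : Set.Ioo (0 : ℝ) 1 • ((fun x => ‖T x‖⁻¹ • (T x)) '' A) =
      (T : EuclideanSpace ℝ (Fin (n + 1)) →ₗ[ℝ] EuclideanSpace ℝ (Fin (n + 1))) ''
        (Subtype.val '' (homeomorphUnitSphereProd (EuclideanSpace ℝ (Fin (n + 1))) ⁻¹' P)) := by
    rw [← Homeomorph.image_symm]
    ext y
    constructor
    · rintro ⟨r, hr, _, ⟨x, hx, rfl⟩, rfl⟩
      have hp := hTpos x (hne x (hA hx))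
      refine ⟨_, ⟨_, ⟨(⟨x, hA hx⟩, ⟨r * ‖T x‖⁻¹, mul_pos hr.1 (inv_pos.2 hp)⟩), ⟨hx, ?_⟩, rfl⟩, rfl⟩, ?_⟩
      · exact mul_lt_of_lt_one_left (inv_pos.2 hp) hr.2
      · simp [homeomorphUnitSphereProd, smul_smul]
    · rintro ⟨_, ⟨_, ⟨⟨⟨x, hxS⟩, ⟨r, hr⟩⟩, ⟨hx, hlt⟩, rfl⟩, rfl⟩, rfl⟩
      have hp := hTpos x (hne x hxS)
      have hr : 0 < r := hr
      simp only at hlt hx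
      refine ⟨r * ‖T x‖, ⟨mul_pos hr hp, ?_⟩, _, ⟨x, hx, rfl⟩, ?_⟩
      · calc r * ‖T x‖ < ‖T x‖⁻¹ * ‖T x‖ := by gcongr
          _ = 1 := inv_mul_cancel₀ hp.ne'
      · simp [homeomorphUnitSphereProd, smul_smul, mul_assoc, mul_inv_cancel₀ hp.ne']
  rw [hcone, Measure.addHaar_image_linearMap,
    ← comap_subtype_coe_apply (measurableSet_singleton _).compl,
    ((volume : Measure (EuclideanSpace ℝ (Fin (n + 1)))).measurePreserving_homeomorphUnitSphereProd).measure_preimage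
      hPm.nullMeasurableSet, Measure.prod_apply hPm]
  have hfm : Measurable fun p : EuclideanSpace ℝ (Fin (n + 1)) => ENNReal.ofReal
            (|LinearMap.det (T : EuclideanSpace ℝ (Fin (n + 1)) →ₗ[ℝ]
                EuclideanSpace ℝ (Fin (n + 1)))| / ‖T p‖ ^ (n + 1)) :=
    (measurable_const.div (hTc.measurable.norm.pow_const _)).ennreal_ofReal
  rw [setLIntegral_map hAm hfm measurable_subtype_coe,
    ← lintegral_indicator (measurable_subtype_coe hAm), ← mul_assoc, ← lintegral_const_mul]
  swap
  · exact measurable_measure_prodMk_left hPm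
  refine lintegral_congr fun p => ?_
  have hp := hTpos p (hne p p.2)
  by_cases hpA : (p : EuclideanSpace ℝ (Fin (n + 1))) ∈ A
  · rw [Set.indicator_of_mem (by exact hpA)]
    have : Prod.mk p ⁻¹' P = Set.Iio (⟨‖T p‖⁻¹, inv_pos.2 hp⟩ : Set.Ioi (0 : ℝ)) := by
      ext r
      simp [P, hpA, ← Subtype.coe_lt_coe]
    rw [this, Measure.volumeIoiPow_apply_Iio, finrank_euclideanSpace_fin, Nat.add_sub_cancel,
      ← ENNReal.ofReal_natCast, ← ENNReal.ofReal_mul (by positivity),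
      ← ENNReal.ofReal_mul (by positivity)]
    congr 1
    push_cast
    rw [inv_pow]
    field_simp
  · rw [Set.indicator_of_notMem (by exact hpA)]
    have : Prod.mk p ⁻¹' P = ∅ := by
      ext r
      simp [P, hpA]
    rw [this]
    simp

/-- The Jacobian formula for the round volume element of the unit sphere under the map
`φ(T) : x ↦ T x / ‖T x‖`: for every measurable `A ⊆ Sⁿ`,
`μ(φ(T)(A)) = ∫_A |det T| / ‖T p‖^{n+1} dμ(p)`, where `μ` is the `n`-dimensional
Hausdorff measure restricted to the sphere. -/
theorem stmt10 (n : ℕ)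
    (T : EuclideanSpace ℝ (Fin (n + 1)) ≃ₗ[ℝ] EuclideanSpace ℝ (Fin (n + 1)))
    (A : Set (EuclideanSpace ℝ (Fin (n + 1))))
    (hA : A ⊆ sphere (0 : EuclideanSpace ℝ (Fin (n + 1))) 1)
    (hAm : MeasurableSet A) :
    (μH[(n : ℝ)].restrict (sphere (0 : EuclideanSpace ℝ (Fin (n + 1))) 1))
        ((fun x => ‖T x‖⁻¹ • (T x)) '' A)
      = ∫⁻ p in A,
          ENNReal.ofReal
            (|LinearMap.det (T : EuclideanSpace ℝ (Fin (n + 1)) →ₗ[ℝ]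
                EuclideanSpace ℝ (Fin (n + 1)))| / ‖T p‖ ^ (n + 1))
          ∂(μH[(n : ℝ)].restrict (sphere (0 : EuclideanSpace ℝ (Fin (n + 1))) 1)) := by
  obtain ⟨c, hc⟩ := aux_prop_sphere n
  rw [hc, Measure.restrict_smul, lintegral_smul_measure, Measure.smul_apply,
    aux_jac n T A hA hAm]
end
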